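/- Let φ(z;a,b) = (2πb)^{−1/2}exp(−(z−a)²/(2b)). Fix π₀ ∈ (0,1), λ ∈ (0,1), μ ∈ ℝ, σ ∈ (0,1), set k = π₀(1−λ)/((1−π₀)λ) and clFDR(z) = π₀φ(z;0,1)/(π₀φ(z;0,1) + (1−π₀)φ(z;μ,σ²)). Suppose the discriminant D = μ²σ² − 2(1−σ²)σ²·log(σk) is positive, and let a = (μ − √D)/(1−σ²) and b = (μ + √D)/(1−σ²). Then the sublevel set {z ∈ ℝ : clFDR(z) ≤ λ} equals the closed interval [a, b]. -/

import Mathlib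

/-- The normal density `φ(z; a, b) = (2πb)^{−1/2} exp(−(z−a)²/(2b))` with mean `a`
and variance `b`. -/
noncomputable def normalDensity (z a b : ℝ) : ℝ :=
  (2 * Real.pi * b) ^ (-(1 : ℝ) / 2) * Real.exp (-(z - a) ^ 2 / (2 * b))

/-- When the discriminant `D = μ²σ² − 2(1−σ²)σ²·log(σk)` is positive, the rejection
region `{z : clFDR(z) ≤ λ}` of the conditional local FDR procedure is exactly the
closed interval `[a, b]` between the two roots `a = (μ − √D)/(1−σ²)` and
`b = (μ + √D)/(1−σ²)` of the associated quadratic. -/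
theorem clFDR_sublevel_set_eq_Icc
    (pi0 lam mu sigma : ℝ)
    (hpi0 : pi0 ∈ Set.Ioo (0 : ℝ) 1) (hlam : lam ∈ Set.Ioo (0 : ℝ) 1)
    (hsigma : sigma ∈ Set.Ioo (0 : ℝ) 1)
    (k : ℝ) (hk : k = pi0 * (1 - lam) / ((1 - pi0) * lam))
    (D : ℝ) (hD : D = mu ^ 2 * sigma ^ 2 - 2 * (1 - sigma ^ 2) * sigma ^ 2 * Real.log (sigma * k))
    (hDpos : 0 < D)
    (a b : ℝ)
    (ha : a = (mu - Real.sqrt D) / (1 - sigma ^ 2))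
    (hb : b = (mu + Real.sqrt D) / (1 - sigma ^ 2))
    (clFDR : ℝ → ℝ)
    (hclFDR : ∀ z, clFDR z = pi0 * normalDensity z 0 1 /
      (pi0 * normalDensity z 0 1 + (1 - pi0) * normalDensity z mu (sigma ^ 2))) :
    {z : ℝ | clFDR z ≤ lam} = Set.Icc a b := by
  obtain ⟨hp0, hp1⟩ := hpi0
  obtain ⟨hl0, hl1⟩ := hlam
  obtain ⟨hs0, hs1⟩ := hsigma
  have hs : 0 < 1 - sigma ^ 2 := by nlinarith
  have hp1' : 0 < 1 - pi0 := by linarith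
  have hl1' : 0 < 1 - lam := by linarith
  have hkpos : 0 < k := by rw [hk]; positivity
  have hkeq : k * ((1 - pi0) * lam) = pi0 * (1 - lam) := by
    rw [hk]; field_simp
  have hskpos : 0 < sigma * k := by positivity
  obtain ⟨C, hC⟩ : ∃ C : ℝ, C = (2 * Real.pi) ^ (-(1 : ℝ) / 2) := ⟨_, rfl⟩
  have hCpos : 0 < C := by rw [hC]; positivity
  have hsr : (sigma ^ 2) ^ (-(1 : ℝ) / 2) = sigma⁻¹ := by
    rw [← Real.rpow_natCast, ← Real.rpow_mul hs0.le]
    norm_num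
    exact Real.rpow_neg_one sigma
  ext z
  simp only [Set.mem_setOf_eq, Set.mem_Icc]
  have h0 : normalDensity z 0 1 = C * Real.exp (-z ^ 2 / 2) := by
    simp [normalDensity, hC]
  have h1 : normalDensity z mu (sigma ^ 2)
      = C * sigma⁻¹ * Real.exp (-(z - mu) ^ 2 / (2 * sigma ^ 2)) := by
    rw [normalDensity, Real.mul_rpow (by positivity) (by positivity), hsr, hC]
  have hE0 := Real.exp_pos (-z ^ 2 / 2)
  have hE1 := Real.exp_pos (-(z - mu) ^ 2 / (2 * sigma ^ 2))
  have step1 : clFDR z ≤ lam ↔ sigma * k * Real.exp (-z ^ 2 / 2)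
      ≤ Real.exp (-(z - mu) ^ 2 / (2 * sigma ^ 2)) := by
    rw [hclFDR, h0, h1, div_le_iff₀ (by positivity)]
    generalize Real.exp (-z ^ 2 / 2) = E0 at *
    generalize Real.exp (-(z - mu) ^ 2 / (2 * sigma ^ 2)) = E1 at *
    have hM : 0 < (1 - pi0) * lam * C * sigma⁻¹ := by positivity
    have e : lam * (pi0 * (C * E0) + (1 - pi0) * (C * sigma⁻¹ * E1)) - pi0 * (C * E0)
        = ((1 - pi0) * lam * C * sigma⁻¹) * (E1 - sigma * k * E0) := by
      have hss : sigma⁻¹ * sigma = 1 := inv_mul_cancel₀ hs0.ne'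
      linear_combination (C * E0) * hkeq + (1 - pi0) * lam * C * k * E0 * hss
    rw [← sub_nonneg, e, mul_nonneg_iff_of_pos_left hM, sub_nonneg]
  have step2 : sigma * k * Real.exp (-z ^ 2 / 2)
      ≤ Real.exp (-(z - mu) ^ 2 / (2 * sigma ^ 2)) ↔
      ((1 - sigma ^ 2) * z - mu) ^ 2 ≤ D := by
    nth_rewrite 1 [← Real.exp_log hskpos]
    rw [← Real.exp_add, Real.exp_le_exp, hD]
    generalize Real.log (sigma * k) = L
    have hM : 0 < 2 * sigma ^ 2 * (1 - sigma ^ 2) := by positivity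
    have e : mu ^ 2 * sigma ^ 2 - 2 * (1 - sigma ^ 2) * sigma ^ 2 * L
        - ((1 - sigma ^ 2) * z - mu) ^ 2 = (2 * sigma ^ 2 * (1 - sigma ^ 2)) *
        (-(z - mu) ^ 2 / (2 * sigma ^ 2) - (L + -z ^ 2 / 2)) := by
      field_simp
      ring
    rw [← sub_nonneg, ← sub_nonneg (b := ((1 - sigma ^ 2) * z - mu) ^ 2), e,
      mul_nonneg_iff_of_pos_left hM]
  rw [step1, step2, Real.sq_le hDpos.le, ha, hb, div_le_iff₀ hs, le_div_iff₀ hs]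
  constructor <;> rintro ⟨h, h'⟩ <;> constructor <;> linarith
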